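/- arXiv:1007.0941 — 2 statements merged into one kernel-verified Lean document; each statement's English description precedes it below -/
import Mathlib

section
/- Let E be a q-uniformly smooth real Banach space, A : E → E L-Lipschitzian strongly accretive with constant η > 0, T : E → E nonexpansive with F(T) ≠ ∅, u ∈ E fixed, 0 < λ < (qη/(L^q d_q))^{1/(q−1)}. Then the path z_t = t u + (I − tλA)Tz_t converges strongly as t → 0⁺ to some x′ ∈ F(T) which solves the variational inequality ⟨u − λAx′, j_q(p − x′)⟩ ≤ 0 for all p ∈ F(T). -/
open Filter Topology in
lemma exists_small_rpow (q : ℝ) (hq : 1 < q) (c e b : ℝ) (he : 0 < e) (hb : 0 < b) :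
    ∃ s : ℝ, 0 < s ∧ s < b ∧ c * s ^ q ≤ e * s := by
  have h1 : Tendsto (fun s : ℝ => c * s ^ (q - 1)) (𝓝[>] 0) (𝓝 0) := by
    have h2 : ContinuousAt (fun s : ℝ => c * s ^ (q - 1)) 0 :=
      continuousAt_const.mul (Real.continuousAt_rpow_const 0 (q - 1) (Or.inr (by linarith)))
    have h3 := h2.tendsto
    rw [Real.zero_rpow (by linarith), mul_zero] at h3
    exact h3.mono_left nhdsWithin_le_nhds
  have h4 : ∀ᶠ s in 𝓝[>] (0 : ℝ), c * s ^ (q - 1) < e := h1.eventually (gt_mem_nhds he)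
  have h5 : ∀ᶠ s in 𝓝[>] (0 : ℝ), s ∈ Set.Ioo 0 b := Ioo_mem_nhdsGT hb
  obtain ⟨s, hs, hs0, hsb⟩ := (h4.and h5).exists
  refine ⟨s, hs0, hsb, ?_⟩
  have : s ^ q = s ^ (q - 1) * s := by
    rw [← Real.rpow_add_one hs0.ne']; ring_nf
  rw [this, ← mul_assoc]
  exact mul_le_mul_of_nonneg_right hs.le hs0.le

/-- A form of uniform smoothness. -/
def USmooth (E : Type*) [NormedAddCommGroup E] [NormedSpace ℝ E] : Prop :=
  ∀ e : ℝ, 0 < e → ∃ s : ℝ, 0 < s ∧ s < 1 ∧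
    ∀ x y : E, ‖x‖ ≤ 1 → ‖y‖ ≤ 1 → ‖x + s • y‖ + ‖x - s • y‖ ≤ 2 + e * s

lemma usmooth_of_q {E : Type*} [NormedAddCommGroup E] [NormedSpace ℝ E]
    (q : ℝ) (hq : 1 < q) (jq : E → E →L[ℝ] ℝ) (dq : ℝ) (hdq : 0 < dq)
    (hsmooth : ∀ x y : E, ‖x + y‖ ^ q ≤ ‖x‖ ^ q + q * jq x y + dq * ‖y‖ ^ q) :
    USmooth E := by
  intro e he
  obtain ⟨s, hs0, hs1, hs⟩ := exists_small_rpow q hq (2 * dq) e 1 he one_pos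
  refine ⟨s, hs0, hs1, fun x y hx hy => ?_⟩
  have h1 := hsmooth x (s • y)
  have h2 := hsmooth x (-(s • y))
  rw [← sub_eq_add_neg, map_neg, norm_neg] at h2
  have hxq : ‖x‖ ^ q ≤ 1 := Real.rpow_le_one (norm_nonneg _) hx (by linarith)
  have hyq : ‖s • y‖ ^ q ≤ s ^ q := by
    apply Real.rpow_le_rpow (norm_nonneg _) _ (by linarith)
    rw [norm_smul, Real.norm_of_nonneg hs0.le]
    nlinarith
  have b1 := one_add_mul_self_le_rpow_one_add (s := ‖x + s • y‖ - 1)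
    (by linarith [norm_nonneg (x + s • y)]) hq.le
  have b2 := one_add_mul_self_le_rpow_one_add (s := ‖x - s • y‖ - 1)
    (by linarith [norm_nonneg (x - s • y)]) hq.le
  rw [add_sub_cancel] at b1 b2
  have h3 := mul_le_mul_of_nonneg_left hyq hdq.le
  have h4 : q * (‖x + s • y‖ + ‖x - s • y‖ - 2) ≤ e * s := by nlinarith
  by_contra hcon
  push Not at hcon
  have : 0 ≤ e * s := by positivity
  nlinarith

/-- Averages of functionals. -/
noncomputable def avgF {E : Type*} [NormedAddCommGroup E] [NormedSpace ℝ E]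
    (f : ℕ → E →L[ℝ] ℝ) : ℕ → ℕ → E →L[ℝ] ℝ
  | 0, a => f a
  | k + 1, a => (1 / 2 : ℝ) • (avgF f k a + avgF f k (a + 2 ^ k))

lemma no_james {E : Type*} [NormedAddCommGroup E] [NormedSpace ℝ E] (hU : USmooth E)
    (κ : ℝ) (hκ : 0 < κ) : ∃ N : ℕ, ∀ (f : ℕ → E →L[ℝ] ℝ) (x : ℕ → E),
      (∀ n, ‖f n‖ ≤ 1) → (∀ n, ‖x n‖ ≤ 1) →
      (∀ m n, m ≤ n → n < N → κ ≤ f m (x n)) →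
      (∀ m n, n < m → m < N → f m (x n) ≤ κ / 2) → False := by
  obtain ⟨s, hs0, hs1, hs⟩ := hU (κ / 4) (by linarith)
  obtain ⟨K, hK⟩ := exists_nat_gt (1 / (s * κ / 8))
  have hKpos : 1 < K * (s * κ / 8) := by
    rwa [div_lt_iff₀ (by positivity)] at hK
  refine ⟨2 ^ K, fun f x hf hx hge hle => ?_⟩
  have key : ∀ k a, a + 2 ^ k ≤ 2 ^ K →
      (∀ i, a + 2 ^ k ≤ i + 1 → i < 2 ^ K → κ ≤ avgF f k a (x i)) ∧
      (∀ i, i < a → avgF f k a (x i) ≤ κ / 2) ∧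
      ‖avgF f k a‖ ≤ 1 - k * (s * κ / 8) := by
    intro k
    induction k with
    | zero =>
      intro a ha
      simp only [pow_zero] at ha
      refine ⟨fun i hi hi' => ?_, fun i hi => ?_, ?_⟩
      · exact hge a i (by simpa using hi) hi'
      · exact hle a i hi (by omega)
      · simpa [avgF] using hf a
    | succ k ih =>
      intro a ha
      have hp : 0 < 2 ^ k := by positivity
      rw [pow_succ] at ha
      obtain ⟨p1, p2, p3⟩ := ih a (by omega)
      obtain ⟨r1, r2, r3⟩ := ih (a + 2 ^ k) (by omega)
      have hev : ∀ w, avgF f (k + 1) a w =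
          (1 / 2 : ℝ) * (avgF f k a w + avgF f k (a + 2 ^ k) w) := by
        intro w; simp [avgF]; ring
      refine ⟨fun i hi hi' => ?_, fun i hi => ?_, ?_⟩
      · rw [pow_succ] at hi
        rw [hev]
        have := p1 i (by omega) hi'
        have := r1 i (by omega) hi'
        linarith
      · rw [hev]
        have := p2 i hi
        have := r2 i (by omega)
        linarith
      · set g := avgF f k a with hg
        set h := avgF f k (a + 2 ^ k) with hh
        set R := 1 - k * (s * κ / 8) with hR
        set y := x (a + 2 ^ k - 1) with hy
        have hy1 : ‖y‖ ≤ 1 := hx _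
        have hgy : κ ≤ g y := p1 _ (by omega) (by omega)
        have hhy : h y ≤ κ / 2 := r2 _ (by omega)
        have hR0 : 0 ≤ R := (norm_nonneg _).trans p3
        have hR1 : R ≤ 1 := by
          have : 0 ≤ k * (s * κ / 8) := by positivity
          linarith
        have hunit : ∀ w : E, ‖w‖ ≤ 1 → avgF f (k + 1) a w ≤ R - s * κ / 8 := by
          intro w hw
          have h1 := hs w y hw hy1
          have h2 : g (w + s • y) ≤ R * ‖w + s • y‖ :=
            (le_abs_self _).trans (g.le_of_opNorm_le p3 _)
          have h3 : h (w - s • y) ≤ R * ‖w - s • y‖ :=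
            (le_abs_self _).trans (h.le_of_opNorm_le r3 _)
          have h4 : R * ‖w + s • y‖ + R * ‖w - s • y‖ ≤ R * 2 + κ / 4 * s := by
            have := mul_le_mul_of_nonneg_left h1 hR0
            have : R * (κ / 4 * s) ≤ κ / 4 * s := mul_le_of_le_one_left (by positivity) hR1
            linarith
          rw [map_add, map_smul, smul_eq_mul] at h2
          rw [map_sub, map_smul, smul_eq_mul] at h3
          have h5 : s * (κ / 2) ≤ s * (g y - h y) :=
            mul_le_mul_of_nonneg_left (by linarith) hs0.le
          rw [hev]
          nlinarith
        have hnn : 0 ≤ R - s * κ / 8 := by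
          have := hunit 0 (by simp)
          simpa using this
        have := ContinuousLinearMap.opNorm_le_of_unit_norm (f := avgF f (k + 1) a) hnn
          (fun w hw => by
            rw [Real.norm_eq_abs, abs_le]
            constructor
            · have := hunit (-w) (by rw [norm_neg, hw])
              rw [map_neg] at this
              linarith
            · exact hunit w hw.le)
        refine this.trans (le_of_eq ?_)
        rw [hR]; push_cast; ring
  have := (key K 0 (by simp)).2.2
  have h0 := norm_nonneg (avgF f K 0)
  linarith

/-- Uniform normal structure, unit scale. -/
lemma uns_unit {E : Type*} [NormedAddCommGroup E] [NormedSpace ℝ E] (hU : USmooth E) :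
    ∃ ε : ℝ, 0 < ε ∧ ε < 1 ∧ ∀ C : Set E, Convex ℝ C → C.Nonempty →
      (∀ x ∈ C, ∀ y ∈ C, ‖x - y‖ ≤ 1) → ∃ x ∈ C, ∀ y ∈ C, ‖y - x‖ ≤ 1 - ε := by
  obtain ⟨s, hs0, hs1, hs⟩ := hU (1 / 4) (by norm_num)
  obtain ⟨N, hN⟩ := no_james hU (s / 4) (by linarith)
  have h2N : (1 : ℝ) ≤ 2 ^ N := one_le_pow₀ (by norm_num)
  refine ⟨s / 8 / 2 ^ N, by positivity, ?_, fun C hC hne hd => ?_⟩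
  · rw [div_lt_one (by positivity)]; linarith
  set ε := s / 8 / 2 ^ N with hε
  have hεpos : 0 < ε := by positivity
  have hεN : 2 ^ N * ε = s / 8 := by rw [hε]; field_simp
  by_contra hcon
  push Not at hcon
  have hY : ∀ x : E, ∃ y : E, x ∈ C → y ∈ C ∧ 1 - ε < ‖y - x‖ := by
    intro x
    by_cases hx : x ∈ C
    · obtain ⟨y, hy, h⟩ := hcon x hx
      exact ⟨y, fun _ => ⟨hy, h⟩⟩
    · exact ⟨x, fun h => absurd h hx⟩
  choose Y hY using hY
  obtain ⟨b, hb⟩ := hne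
  let c : ℕ → E := fun n => (fun w => (1 / 2 : ℝ) • w + (1 / 2 : ℝ) • Y w)^[n] b
  have hc0 : c 0 = b := rfl
  have hcs : ∀ n, c (n + 1) = (1 / 2 : ℝ) • c n + (1 / 2 : ℝ) • Y (c n) := by
    intro n
    simp only [c, Function.iterate_succ_apply']
  have hcC : ∀ n, c n ∈ C := by
    intro n
    induction n with
    | zero => exact hb
    | succ n ih =>
      rw [hcs]
      exact hC ih (hY _ ih).1 (by norm_num) (by norm_num) (by norm_num)
  have hxC : ∀ n, Y (c n) ∈ C := fun n => (hY _ (hcC n)).1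
  have hf : ∀ n, ∃ f : E →L[ℝ] ℝ, ‖f‖ ≤ 1 ∧ f (Y (c n) - c n) = ‖Y (c n) - c n‖ := by
    intro n
    obtain ⟨g, hg, hg'⟩ := exists_dual_vector'' ℝ (Y (c n) - c n)
    exact ⟨g, hg, by simpa using hg'⟩
  choose f hf1 hf2 using hf
  have hfle : ∀ n w, ‖w‖ ≤ 1 → f n w ≤ 1 := fun n w hw =>
    (le_abs_self _).trans (((f n).le_of_opNorm_le (hf1 n) w).trans (by linarith))
  have hback : ∀ k i, 1 - 2 ^ k * ε ≤ f (i + k) (Y (c (i + k)) - c i) := by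
    intro k
    induction k with
    | zero =>
      intro i
      have := (hY _ (hcC i)).2
      simp only [add_zero, pow_zero, one_mul]
      rw [hf2]; exact this.le
    | succ k ih =>
      intro i
      have h1 := ih (i + 1)
      rw [show i + 1 + k = i + (k + 1) by ring, hcs i] at h1
      have h2 := hfle (i + (k + 1)) (Y (c (i + (k + 1))) - Y (c i)) (hd _ (hxC _) _ (hxC _))
      simp only [map_sub, map_add, map_smul, smul_eq_mul] at h1 h2 ⊢
      rw [pow_succ]
      linarith
  have hbackx : ∀ k i, 1 - 2 ^ (k + 1) * ε ≤ f (i + 1 + k) (Y (c (i + 1 + k)) - Y (c i)) := by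
    intro k i
    have h1 := hback k (i + 1)
    rw [hcs i] at h1
    have h2 := hfle (i + 1 + k) (Y (c (i + 1 + k)) - c i) (hd _ (hxC _) _ (hcC _))
    simp only [map_sub, map_add, map_smul, smul_eq_mul] at h1 h2 ⊢
    rw [pow_succ]
    linarith
  have hpw : ∀ k, k ≤ N → 2 ^ k * ε ≤ s / 8 := by
    intro k hk
    rw [← hεN]
    exact mul_le_mul_of_nonneg_right (pow_le_pow_right₀ (by norm_num) hk) hεpos.le
  have e1 : ∀ n, n < N → 1 - s / 8 ≤ f n (Y (c n) - b) := by
    intro n hn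
    have := hback n 0
    rw [zero_add, hc0] at this
    linarith [hpw n hn.le]
  have e2 : ∀ i n, i < n → n < N → 1 - s / 8 ≤ f n (Y (c n) - Y (c i)) := by
    intro i n hi hn
    obtain ⟨k, rfl⟩ := Nat.exists_eq_add_of_le (Nat.succ_le_of_lt hi)
    have := hbackx k i
    have := hpw (k + 1) (by omega)
    simp only [Nat.succ_eq_add_one]
    linarith
  refine hN f (fun n => Y (c n) - b) hf1 (fun n => hd _ (hxC _) _ hb) ?_ ?_
  · intro m n hmn hn
    rcases hmn.eq_or_lt with rfl | hmn
    · have := e1 m hn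
      linarith
    · have hm := e1 m (hmn.trans hn)
      have hnn := e1 n hn
      have hnm := e2 m n hmn hn
      have h1 := hs (Y (c n) - Y (c m)) (Y (c n) - b) (hd _ (hxC _) _ (hxC _))
        (hd _ (hxC _) _ hb)
      have h2 : f n ((Y (c n) - Y (c m)) + s • (Y (c n) - b)) ≤
          1 * ‖(Y (c n) - Y (c m)) + s • (Y (c n) - b)‖ :=
        (le_abs_self _).trans ((f n).le_of_opNorm_le (hf1 n) _)
      have h3 : f m (-((Y (c n) - Y (c m)) - s • (Y (c n) - b))) ≤
          1 * ‖-((Y (c n) - Y (c m)) - s • (Y (c n) - b))‖ :=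
        (le_abs_self _).trans ((f m).le_of_opNorm_le (hf1 m) _)
      rw [norm_neg] at h3
      simp only [map_sub, map_add, map_smul, map_neg, smul_eq_mul] at h2 h3 hm hnn hnm ⊢
      by_contra hlt
      push Not at hlt
      nlinarith
  · intro m n hnm hm
    have h1 := hfle m (Y (c m) - b) (hd _ (hxC _) _ hb)
    have h2 := e2 n m hnm hm
    simp only [map_sub] at h1 h2 ⊢
    linarith

lemma uns {E : Type*} [NormedAddCommGroup E] [NormedSpace ℝ E] (hU : USmooth E) :
    ∃ ρ : ℝ, 0 < ρ ∧ ρ < 1 ∧ ∀ (C : Set E) (d : ℝ), 0 < d → Convex ℝ C → C.Nonempty →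
      (∀ x ∈ C, ∀ y ∈ C, ‖x - y‖ ≤ d) → ∃ x ∈ C, ∀ y ∈ C, ‖y - x‖ ≤ ρ * d := by
  obtain ⟨ε, h0, h1, h⟩ := uns_unit hU
  refine ⟨1 - ε, by linarith, by linarith, fun C d hd0 hC hne hd => ?_⟩
  obtain ⟨x, hx, hxy⟩ := h ((fun w => d⁻¹ • w) '' C) (hC.is_linear_image
      (IsLinearMap.isLinearMap_smul _)) (hne.image _) (by
    rintro _ ⟨x, hx, rfl⟩ _ ⟨y, hy, rfl⟩
    simp only []
    rw [← smul_sub, norm_smul, norm_inv, Real.norm_of_nonneg hd0.le,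
      inv_mul_le_iff₀ hd0, mul_one]
    exact hd x hx y hy)
  obtain ⟨x, hx, rfl⟩ := hx
  refine ⟨x, hx, fun y hy => ?_⟩
  have := hxy _ ⟨y, hy, rfl⟩
  simp only [] at this
  rw [← smul_sub, norm_smul, norm_inv, Real.norm_of_nonneg hd0.le,
      inv_mul_le_iff₀ hd0] at this
  linarith

lemma fpp_step {E : Type*} [NormedAddCommGroup E] [NormedSpace ℝ E]
    (ρ : ℝ) (hρ : ∀ (C : Set E) (d : ℝ), 0 < d → Convex ℝ C → C.Nonempty →
      (∀ x ∈ C, ∀ y ∈ C, ‖x - y‖ ≤ d) → ∃ x ∈ C, ∀ y ∈ C, ‖y - x‖ ≤ ρ * d)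
    (T : E → E) (hT : ∀ x y : E, ‖T x - T y‖ ≤ ‖x - y‖)
    (C : Set E) (d : ℝ) (hd0 : 0 < d) (hC : Convex ℝ C) (hCc : IsClosed C) (hne : C.Nonempty)
    (hTC : ∀ x ∈ C, T x ∈ C) (hd : ∀ x ∈ C, ∀ y ∈ C, ‖x - y‖ ≤ d) :
    ∃ C' : Set E, C' ⊆ C ∧ Convex ℝ C' ∧ IsClosed C' ∧ C'.Nonempty ∧ (∀ x ∈ C', T x ∈ C') ∧
      (∀ x ∈ C', ∀ y ∈ C', ‖x - y‖ ≤ ρ * d) := by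
  set r := ρ * d with hr
  obtain ⟨x0, hx0, hx0r⟩ := hρ C d hd0 hC hne hd
  let S : Set E := {x | x ∈ C ∧ ∀ y ∈ C, ‖y - x‖ ≤ r}
  let Fam : Set (Set E) := {D | IsClosed D ∧ Convex ℝ D ∧ (∀ x ∈ D, T x ∈ D) ∧ S ⊆ D}
  have hCF : C ∈ Fam := ⟨hCc, hC, hTC, fun x hx => hx.1⟩
  let L : Set E := ⋂₀ Fam
  have hLC : L ⊆ C := Set.sInter_subset_of_mem hCF
  have hSL : S ⊆ L := Set.subset_sInter fun D hD => hD.2.2.2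
  have hLc : IsClosed L := isClosed_sInter fun D hD => hD.1
  have hLconv : Convex ℝ L := convex_sInter fun D hD => hD.2.1
  have hLT : ∀ x ∈ L, T x ∈ L := fun x hx D hD => hD.2.2.1 x (hx D hD)
  have hball : {z : E | ∀ y ∈ L, ‖y - z‖ ≤ r} = ⋂ y ∈ L, Metric.closedBall y r := by
    ext z
    simp only [Set.mem_ofPred_eq, Set.mem_iInter, Metric.mem_closedBall]
    refine forall₂_congr fun y _ => ?_
    rw [dist_comm, dist_eq_norm]
  refine ⟨L ∩ {z : E | ∀ y ∈ L, ‖y - z‖ ≤ r}, fun x hx => hLC hx.1, ?_, ?_, ?_, ?_, ?_⟩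
  · rw [hball]
    exact hLconv.inter (convex_iInter₂ fun y _ => convex_closedBall y r)
  · rw [hball]
    exact hLc.inter (isClosed_biInter fun y _ => Metric.isClosed_closedBall)
  · exact ⟨x0, hSL ⟨hx0, hx0r⟩, fun y hy => hx0r y (hLC hy)⟩
  · rintro z ⟨hzL, hz⟩
    refine ⟨hLT z hzL, fun y hy => ?_⟩
    have hD : L ∩ Metric.closedBall (T z) r ∈ Fam := by
      refine ⟨hLc.inter Metric.isClosed_closedBall, hLconv.inter (convex_closedBall _ _), ?_, ?_⟩
      · rintro w ⟨hwL, _⟩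
        refine ⟨hLT w hwL, ?_⟩
        rw [Metric.mem_closedBall, dist_eq_norm]
        exact (hT w z).trans (hz w hwL)
      · intro w hw
        refine ⟨hSL hw, ?_⟩
        rw [Metric.mem_closedBall, dist_comm, dist_eq_norm]
        exact hw.2 _ (hLC (hLT z hzL))
    have := (hy _ hD).2
    rwa [Metric.mem_closedBall, dist_eq_norm] at this
  · rintro x ⟨hxL, _⟩ y ⟨_, hy⟩
    exact hy x hxL

open Filter Topology in
lemma fpp {E : Type*} [NormedAddCommGroup E] [NormedSpace ℝ E] [CompleteSpace E]
    (hU : USmooth E)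
    (T : E → E) (hT : ∀ x y : E, ‖T x - T y‖ ≤ ‖x - y‖)
    (C : Set E) (d : ℝ) (hd0 : 0 < d) (hC : Convex ℝ C) (hCc : IsClosed C) (hne : C.Nonempty)
    (hTC : ∀ x ∈ C, T x ∈ C) (hd : ∀ x ∈ C, ∀ y ∈ C, ‖x - y‖ ≤ d) :
    ∃ x ∈ C, T x = x := by
  obtain ⟨ρ, hρ0, hρ1, hρ⟩ := uns hU
  let P : Set E → ℝ → Prop := fun C d => 0 < d ∧ Convex ℝ C ∧ IsClosed C ∧ C.Nonempty ∧
    (∀ x ∈ C, T x ∈ C) ∧ (∀ x ∈ C, ∀ y ∈ C, ‖x - y‖ ≤ d)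
  have hstep : ∀ (C : Set E) (d : ℝ), ∃ C' : Set E, P C d → C' ⊆ C ∧ P C' (ρ * d) := by
    intro C d
    by_cases h : P C d
    · obtain ⟨a1, a2, a3, a4, a5, a6⟩ := h
      obtain ⟨C', b0, b1, b2, b3, b4, b5⟩ := fpp_step ρ hρ T hT C d a1 a2 a3 a4 a5 a6
      exact ⟨C', fun _ => ⟨b0, by positivity, b1, b2, b3, b4, b5⟩⟩
    · exact ⟨C, fun h' => absurd h' h⟩
  choose nx hnx using hstep
  let D : ℕ → Set E := fun n => Nat.rec C (fun n X => nx X (ρ ^ n * d)) n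
  have hD0 : D 0 = C := rfl
  have hDs : ∀ n, D (n + 1) = nx (D n) (ρ ^ n * d) := fun n => rfl
  have hP : ∀ n, P (D n) (ρ ^ n * d) := by
    intro n
    induction n with
    | zero => rw [hD0, pow_zero, one_mul]; exact ⟨hd0, hC, hCc, hne, hTC, hd⟩
    | succ n ih =>
      rw [hDs, pow_succ', mul_assoc]
      exact (hnx _ _ ih).2
  have hanti : Antitone D := antitone_nat_of_succ_le fun n => by
    rw [hDs]; exact (hnx _ _ (hP n)).1
  choose x hx using fun n => (hP n).2.2.2.1
  have hlim : Tendsto (fun n => ρ ^ n * d) atTop (𝓝 0) := by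
    simpa using (tendsto_pow_atTop_nhds_zero_of_lt_one hρ0.le hρ1).mul_const d
  have hcau : CauchySeq x := by
    refine cauchySeq_of_le_tendsto_0 (fun n => ρ ^ n * d) (fun n m N hn hm => ?_) hlim
    rw [dist_eq_norm]
    exact (hP N).2.2.2.2.2 _ (hanti hn (hx n)) _ (hanti hm (hx m))
  obtain ⟨a, ha⟩ := cauchySeq_tendsto_of_complete hcau
  have haD : ∀ n, a ∈ D n := fun n =>
    (hP n).2.2.1.mem_of_tendsto ha (eventually_atTop.2 ⟨n, fun m hm => hanti hm (hx m)⟩)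
  refine ⟨a, haD 0, ?_⟩
  have h1 : ‖T a - a‖ ≤ 0 := ge_of_tendsto' hlim fun n =>
    (hP n).2.2.2.2.2 _ ((hP n).2.2.2.2.1 _ (haD n)) _ (haD n)
  exact sub_eq_zero.1 (norm_le_zero_iff.1 h1)

open Filter Topology in
/-- Approximate asymptotic centres that are fixed points. -/
lemma exists_fixed_center {E : Type*} [NormedAddCommGroup E] [NormedSpace ℝ E] [CompleteSpace E]
    (hU : USmooth E) (T : E → E) (hT : ∀ x y : E, ‖T x - T y‖ ≤ ‖x - y‖)
    {ι : Type*} (l : Filter ι) [l.NeBot] (z : ι → E)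
    (hzT : Tendsto (fun t => ‖z t - T (z t)‖) l (𝓝 0))
    (x : E) (ρ : ℝ) (hx : ∀ᶠ t in l, ‖z t - x‖ ≤ ρ) :
    ∃ p, T p = p ∧ ∀ ρ' > ρ, ∀ᶠ t in l, ‖z t - p‖ ≤ ρ' := by
  have hρ : 0 ≤ ρ := by
    obtain ⟨t, ht⟩ := hx.exists
    exact (norm_nonneg _).trans ht
  let K : Set E := {y | ∀ ρ' > ρ, ∀ᶠ t in l, ‖z t - y‖ ≤ ρ'}
  suffices h : ∃ p ∈ K, T p = p by
    obtain ⟨p, hp, hTp⟩ := h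
    exact ⟨p, hTp, hp⟩
  refine fpp hU T hT K (2 * (ρ + 1)) (by linarith) ?_ ?_ ?_ ?_ ?_
  · intro a ha b hb α β hα hβ hαβ ρ' hρ'
    filter_upwards [ha ρ' hρ', hb ρ' hρ'] with t h1 h2
    have : z t - (α • a + β • b) = α • (z t - a) + β • (z t - b) := by
      rw [smul_sub, smul_sub, sub_add_sub_comm, ← add_smul, hαβ, one_smul]
    rw [this]
    refine (norm_add_le _ _).trans ?_
    rw [norm_smul, norm_smul, Real.norm_of_nonneg hα, Real.norm_of_nonneg hβ]
    calc α * ‖z t - a‖ + β * ‖z t - b‖ ≤ α * ρ' + β * ρ' := by gcongr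
      _ = ρ' := by rw [← add_mul, hαβ, one_mul]
  · rw [← isSeqClosed_iff_isClosed]
    intro y a hy hya ρ' hρ'
    have hpos : 0 < (ρ' - ρ) / 2 := by linarith
    obtain ⟨n, hn⟩ := ((Metric.tendsto_nhds.1 hya) _ hpos).exists
    filter_upwards [hy n (ρ + (ρ' - ρ) / 2) (by linarith)] with t ht
    rw [dist_eq_norm] at hn
    have := norm_sub_le_norm_sub_add_norm_sub (z t) (y n) a
    linarith
  · exact ⟨x, fun ρ' hρ' => hx.mono fun t ht => ht.trans hρ'.le⟩
  · intro y hy ρ' hρ'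
    have hpos : 0 < (ρ' - ρ) / 2 := by linarith
    filter_upwards [hy (ρ + (ρ' - ρ) / 2) (by linarith), hzT.eventually (gt_mem_nhds hpos)]
      with t h1 h2
    have := norm_sub_le_norm_sub_add_norm_sub (z t) (T (z t)) (T y)
    have := hT (z t) y
    linarith
  · intro a ha b hb
    obtain ⟨t, h1, h2⟩ := ((ha (ρ + 1) (by linarith)).and (hb (ρ + 1) (by linarith))).exists
    have := norm_sub_le_norm_sub_add_norm_sub a (z t) b
    rw [norm_sub_rev a (z t)] at this
    linarith

open Filter Topology in
lemma radius_zero {E : Type*} [NormedAddCommGroup E] [NormedSpace ℝ E] [CompleteSpace E]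
    (hU : USmooth E) (q : ℝ) (hq : 1 < q) (jq : E → E →L[ℝ] ℝ) (dq : ℝ) (hdq : 0 < dq)
    (hsmooth : ∀ x y : E, ‖x + y‖ ^ q ≤ ‖x‖ ^ q + q * jq x y + dq * ‖y‖ ^ q)
    (T : E → E) (hT : ∀ x y : E, ‖T x - T y‖ ≤ ‖x - y‖)
    {ι : Type*} (l : Filter ι) [l.NeBot] (z : ι → E)
    (hzT : Tendsto (fun t => ‖z t - T (z t)‖) l (𝓝 0))
    (p0 : E) (M0 : ℝ) (hM0 : ∀ᶠ t in l, ‖z t - p0‖ ≤ M0)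
    (τ : ℝ) (hτ : 0 < τ) (V : E → E) (LV : ℝ) (hLV : 0 ≤ LV)
    (hV : ∀ x y, ‖V x - V y‖ ≤ LV * ‖x - y‖)
    (hkey : ∀ p, T p = p → ∀ᶠ t in l, τ * ‖z t - p‖ ^ q ≤ q * jq (z t - p) (V p)) :
    ∀ ρ > 0, ∃ p, T p = p ∧ ∀ᶠ t in l, ‖z t - p‖ ≤ ρ := by
  let R : Set ℝ := {ρ | ∃ x, ∀ᶠ t in l, ‖z t - x‖ ≤ ρ}
  have hRnn : ∀ ρ ∈ R, 0 ≤ ρ := by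
    rintro ρ ⟨x, hx⟩
    obtain ⟨t, ht⟩ := hx.exists
    exact (norm_nonneg _).trans ht
  have hbdd : BddBelow R := ⟨0, hRnn⟩
  have hRne : R.Nonempty := ⟨M0, p0, hM0⟩
  set r := sInf R with hr
  have hr0 : 0 ≤ r := le_csInf hRne hRnn
  have hfix : ∀ ρ > r, ∃ p, T p = p ∧ ∀ᶠ t in l, ‖z t - p‖ ≤ ρ := by
    intro ρ hρ
    obtain ⟨ρ1, ⟨x, hx⟩, hlt⟩ := exists_lt_of_csInf_lt hRne hρ
    obtain ⟨p, hp, h⟩ := exists_fixed_center hU T hT l z hzT x ρ1 hx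
    exact ⟨p, hp, h ρ hlt⟩
  have hM00 : 0 ≤ M0 := hRnn M0 ⟨p0, hM0⟩
  set M := ‖V p0‖ + LV * (r + 1 + M0) with hM
  have hMnn : 0 ≤ M := by positivity
  -- the main estimate
  have hmain : ∀ s, 0 < s → s * τ ≤ 1 → ∀ ρ > r, ρ ≤ r + 1 →
      r ^ q ≤ (1 - s * τ) * ρ ^ q + dq * (s ^ q * M ^ q) := by
    intro s hs hsτ ρ hρ hρ1
    have hρ0 : 0 ≤ ρ := hr0.trans hρ.le
    obtain ⟨p, hp, hev⟩ := hfix ρ hρ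
    have hpp0 : ‖p - p0‖ ≤ r + 1 + M0 := by
      obtain ⟨t, h1, h2⟩ := (hev.and hM0).exists
      have := norm_sub_le_norm_sub_add_norm_sub p (z t) p0
      rw [norm_sub_rev p (z t)] at this
      linarith
    have hVp : ‖V p‖ ≤ M := by
      have h1 := hV p p0
      have h2 := mul_le_mul_of_nonneg_left hpp0 hLV
      have h3 := norm_le_norm_add_norm_sub' (V p) (V p0)
      linarith
    set B := (1 - s * τ) * ρ ^ q + dq * (s ^ q * M ^ q) with hB
    have hB0 : 0 ≤ B := by
      have : 0 ≤ 1 - s * τ := by linarith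
      positivity
    have hmem : B ^ (1 / q) ∈ R := by
      refine ⟨p + s • V p, ?_⟩
      filter_upwards [hev, hkey p hp] with t h1 h2
      have h3 := hsmooth (z t - p) (-(s • V p))
      rw [map_neg, map_smul, smul_eq_mul, norm_neg, norm_smul, Real.norm_of_nonneg hs.le,
        Real.mul_rpow hs.le (norm_nonneg _), ← sub_eq_add_neg, sub_sub] at h3
      have h4 : ‖V p‖ ^ q ≤ M ^ q := Real.rpow_le_rpow (norm_nonneg _) hVp (by linarith)
      have h5 : ‖z t - p‖ ^ q ≤ ρ ^ q := Real.rpow_le_rpow (norm_nonneg _) h1 (by linarith)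
      have h6 := mul_le_mul_of_nonneg_left h2 hs.le
      have h7 : dq * (s ^ q * ‖V p‖ ^ q) ≤ dq * (s ^ q * M ^ q) := by gcongr
      have h8 : (1 - s * τ) * ‖z t - p‖ ^ q ≤ (1 - s * τ) * ρ ^ q :=
        mul_le_mul_of_nonneg_left h5 (by linarith)
      have h9 : ‖z t - (p + s • V p)‖ ^ q ≤ B := by
        rw [hB]; linarith
      rw [one_div]
      exact (Real.le_rpow_inv_iff_of_pos (norm_nonneg _) hB0 (by linarith)).2 h9
    have h1 : r ≤ B ^ (1 / q) := csInf_le hbdd hmem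
    rw [one_div] at h1
    exact (Real.le_rpow_inv_iff_of_pos hr0 hB0 (by linarith)).1 h1
  have hmain2 : ∀ s, 0 < s → s * τ ≤ 1 → s * τ * r ^ q ≤ dq * (s ^ q * M ^ q) := by
    intro s hs hsτ
    have hlim : Tendsto (fun ρ : ℝ => (1 - s * τ) * ρ ^ q + dq * (s ^ q * M ^ q)) (𝓝[>] r)
        (𝓝 ((1 - s * τ) * r ^ q + dq * (s ^ q * M ^ q))) := by
      refine Tendsto.mono_left ?_ nhdsWithin_le_nhds
      refine Tendsto.add_const _ (Tendsto.const_mul _ ?_)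
      exact (Real.continuousAt_rpow_const r q (Or.inr (by linarith))).tendsto
    have := ge_of_tendsto hlim (b := r ^ q) (by
      have : ∀ᶠ ρ in 𝓝[>] r, ρ ∈ Set.Ioo r (r + 1) := Ioo_mem_nhdsGT (by linarith)
      filter_upwards [this] with ρ hρ
      exact hmain s hs hsτ ρ hρ.1 hρ.2.le)
    linarith
  have hrz : r = 0 := by
    by_contra hne
    have hrpos : 0 < r := lt_of_le_of_ne hr0 (Ne.symm hne)
    have hrq : 0 < r ^ q := Real.rpow_pos_of_pos hrpos q
    obtain ⟨s, hs0, hs1, hs⟩ := exists_small_rpow q hq (dq * M ^ q) (τ * r ^ q / 2) (1 / τ)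
      (by positivity) (by positivity)
    have h1 := hmain2 s hs0 ((lt_div_iff₀ hτ).1 hs1).le
    have : 0 < s * (τ * r ^ q) := by positivity
    nlinarith
  intro ρ hρ
  exact hfix ρ (by rw [hrz]; exact hρ)

open Filter Topology in
lemma converges_of_radius {E : Type*} [NormedAddCommGroup E] [NormedSpace ℝ E] [CompleteSpace E]
    (T : E → E) (hT : ∀ x y : E, ‖T x - T y‖ ≤ ‖x - y‖)
    {ι : Type*} (l : Filter ι) [l.NeBot] (z : ι → E)
    (h : ∀ ρ > 0, ∃ p, T p = p ∧ ∀ᶠ t in l, ‖z t - p‖ ≤ ρ) :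
    ∃ x, T x = x ∧ Tendsto z l (𝓝 x) := by
  have hc : Cauchy (map z l) := by
    rw [Metric.cauchy_iff]
    refine ⟨inferInstance, fun ε hε => ?_⟩
    obtain ⟨p, _, hp⟩ := h (ε / 3) (by linarith)
    refine ⟨Metric.closedBall p (ε / 3), ?_, ?_⟩
    · rw [mem_map]
      filter_upwards [hp] with t ht
      simpa [dist_eq_norm] using ht
    · intro a ha b hb
      rw [Metric.mem_closedBall] at ha hb
      have := dist_triangle_right a b p
      linarith
  obtain ⟨x, hx⟩ := CompleteSpace.complete hc
  have hx' : Tendsto z l (𝓝 x) := hx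
  refine ⟨x, ?_, hx'⟩
  have : ‖T x - x‖ ≤ 0 := by
    refine le_of_forall_pos_le_add fun ε hε => ?_
    obtain ⟨p, hpT, hp⟩ := h (ε / 2) (by linarith)
    have h1 : ‖x - p‖ ≤ ε / 2 := le_of_tendsto (hx'.sub_const p).norm hp
    have h2 := hT x p
    rw [hpT] at h2
    have h3 := norm_sub_le_norm_sub_add_norm_sub (T x) p x
    rw [norm_sub_rev p x] at h3
    linarith
  exact sub_eq_zero.1 (norm_le_zero_iff.1 this)

open Filter Topology in
lemma jq_limit_nonpos {E : Type*} [NormedAddCommGroup E] [NormedSpace ℝ E]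
    (q : ℝ) (hq : 1 < q) (jq : E → E →L[ℝ] ℝ) (dq : ℝ)
    (hsmooth : ∀ x y : E, ‖x + y‖ ^ q ≤ ‖x‖ ^ q + q * jq x y + dq * ‖y‖ ^ q)
    (hsub : ∀ x y : E, ‖x + y‖ ^ q ≤ ‖x‖ ^ q + q * jq (x + y) y)
    {ι : Type*} (l : Filter ι) [l.NeBot] (w v : ι → E) (w0 v0 : E)
    (hw : Tendsto w l (𝓝 w0)) (hv : Tendsto v l (𝓝 v0))
    (h : ∀ᶠ t in l, jq (w t) (v t) ≤ 0) : jq w0 v0 ≤ 0 := by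
  by_contra hcon
  push Not at hcon
  obtain ⟨s, hs0, -, hs⟩ := exists_small_rpow q hq (dq * ‖v0‖ ^ q) (q * jq w0 v0 / 2) 1
    (by have : 0 < q := by linarith
        positivity) one_pos
  have hcont : Continuous (fun a : E => ‖a‖ ^ q) :=
    continuous_norm.rpow_const fun _ => Or.inr (by linarith)
  have h1 : Tendsto (fun t => ‖w t‖ ^ q) l (𝓝 (‖w0‖ ^ q)) := (hcont.tendsto w0).comp hw
  have h2 : Tendsto (fun t => ‖w t - s • v t‖ ^ q) l (𝓝 (‖w0 - s • v0‖ ^ q)) :=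
    (hcont.tendsto _).comp (hw.sub (hv.const_smul s))
  have h3 : ‖w0‖ ^ q ≤ ‖w0 - s • v0‖ ^ q := by
    refine le_of_tendsto_of_tendsto h1 h2 ?_
    filter_upwards [h] with t ht
    have := hsub (w t - s • v t) (s • v t)
    rw [sub_add_cancel, map_smul, smul_eq_mul] at this
    have : q * (s * jq (w t) (v t)) ≤ 0 :=
      mul_nonpos_of_nonneg_of_nonpos (by linarith) (mul_nonpos_of_nonneg_of_nonpos hs0.le ht)
    linarith
  have h4 := hsmooth w0 (-(s • v0))
  rw [map_neg, map_smul, smul_eq_mul, norm_neg, norm_smul, Real.norm_of_nonneg hs0.le,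
        Real.mul_rpow hs0.le (norm_nonneg _), ← sub_eq_add_neg] at h4
  have : 0 < s * (q * jq w0 v0) := by
    have : 0 < q := by linarith
    positivity
  nlinarith


/-- The implicit path `z_t = t u + (I - tλA) T z_t` converges strongly
as `t → 0⁺` to some `x′ ∈ F(T)` which solves the variational inequality
`⟨u - λAx′, j_q(p - x′)⟩ ≤ 0` for all `p ∈ F(T)`. -/
theorem implicit_path_converges
    {E : Type*} [NormedAddCommGroup E] [NormedSpace ℝ E] [CompleteSpace E]
    (q : ℝ) (hq : 1 < q) (jq : E → E →L[ℝ] ℝ)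
    (hjq : ∀ z : E, jq z z = ‖z‖ ^ q ∧ ‖jq z‖ = ‖z‖ ^ (q - 1))
    (dq : ℝ) (hdq : 0 < dq)
    (hsmooth : ∀ x y : E, ‖x + y‖ ^ q ≤ ‖x‖ ^ q + q * jq x y + dq * ‖y‖ ^ q)
    (hsub : ∀ x y : E, ‖x + y‖ ^ q ≤ ‖x‖ ^ q + q * jq (x + y) y)
    (A : E → E) (L : ℝ) (hL : 0 < L)
    (hLip : ∀ x y : E, ‖A x - A y‖ ≤ L * ‖x - y‖)
    (η : ℝ) (hη : 0 < η)
    (hA : ∀ x y : E, η * ‖x - y‖ ^ q ≤ jq (x - y) (A x - A y))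
    (T : E → E) (hT : ∀ x y : E, ‖T x - T y‖ ≤ ‖x - y‖)
    (hF : ∃ p : E, T p = p)
    (u : E)
    (lam : ℝ) (hlam : 0 < lam) (hlam' : lam < (q * η / (L ^ q * dq)) ^ (1 / (q - 1)))
    (z : ℝ → E)
    (hz : ∀ t ∈ Set.Ioo (0 : ℝ) (min 1 (1 / (q * η * lam - dq * (L * lam) ^ q))),
      z t = t • u + (T (z t) - (t * lam) • A (T (z t)))) :
    ∃ x' : E, T x' = x' ∧
      (∀ p : E, T p = p → jq (p - x') (u - lam • A x') ≤ 0) ∧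
      Filter.Tendsto z
        (nhdsWithin 0 (Set.Ioo (0 : ℝ) (min 1 (1 / (q * η * lam - dq * (L * lam) ^ q)))))
        (nhds x') := by
  have hq0 : 0 < q := by linarith
  set τ := q * η * lam - dq * (L * lam) ^ q with hτdef
  have hτ : 0 < τ := by
    have hpos : 0 < q * η / (L ^ q * dq) := by positivity
    have h1 : lam ^ (q - 1) < q * η / (L ^ q * dq) := by
      have h := Real.rpow_lt_rpow hlam.le hlam' (show 0 < q - 1 by linarith)
      rwa [← Real.rpow_mul hpos.le, one_div, inv_mul_cancel₀ (by linarith), Real.rpow_one] at h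
    rw [lt_div_iff₀ (by positivity)] at h1
    have h2 : lam ^ q = lam ^ (q - 1) * lam := by
      rw [← Real.rpow_add_one hlam.ne']; ring_nf
    have h3 := mul_lt_mul_of_pos_right h1 hlam
    rw [hτdef, Real.mul_rpow hL.le hlam.le, h2]
    linarith
  set b := min 1 (1 / τ) with hb
  have hbpos : 0 < b := lt_min one_pos (by positivity)
  set l := nhdsWithin (0 : ℝ) (Set.Ioo 0 b) with hl
  have hleq : l = nhdsWithin 0 (Set.Ioi 0) := nhdsWithin_Ioo_eq_nhdsGT hbpos
  have : l.NeBot := by rw [hleq]; infer_instance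
  have hmem : ∀ᶠ t in l, t ∈ Set.Ioo 0 b := self_mem_nhdsWithin
  obtain ⟨p0, hp0⟩ := hF
  -- contraction
  have hS : ∀ t ∈ Set.Ioo 0 b, ∀ x y : E,
      ‖(x - (t * lam) • A x) - (y - (t * lam) • A y)‖ ^ q ≤ (1 - t * τ) * ‖x - y‖ ^ q := by
    intro t ht x y
    have ht0 : 0 < t := ht.1
    have ht1 : t < 1 := ht.2.trans_le (min_le_left _ _)
    have hs := hsmooth (x - y) (-((t * lam) • (A x - A y)))
    have heq : (x - (t * lam) • A x) - (y - (t * lam) • A y)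
        = (x - y) + -((t * lam) • (A x - A y)) := by
      rw [smul_sub]; abel
    rw [heq]
    rw [map_neg, map_smul, smul_eq_mul, norm_neg, norm_smul,
      Real.norm_of_nonneg (by positivity)] at hs
    have h1 : (t * lam * ‖A x - A y‖) ^ q ≤ t * ((L * lam) ^ q * ‖x - y‖ ^ q) := by
      have : (t * lam * ‖A x - A y‖) ^ q ≤ (t * ((L * lam) * ‖x - y‖)) ^ q := by
        apply Real.rpow_le_rpow (by positivity) _ hq0.le
        have := mul_le_mul_of_nonneg_left (hLip x y) (show 0 ≤ t * lam by positivity)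
        linarith
      refine this.trans ?_
      rw [Real.mul_rpow ht0.le (by positivity), Real.mul_rpow (by positivity) (norm_nonneg _)]
      have htq : t ^ q ≤ t := by
        simpa using Real.rpow_le_rpow_of_exponent_ge ht0 ht1.le hq.le
      gcongr
    have h2 := mul_le_mul_of_nonneg_left (hA x y) (show 0 ≤ q * (t * lam) by positivity)
    have h3 := mul_le_mul_of_nonneg_left h1 hdq.le
    rw [hτdef]
    nlinarith
  -- key inequality
  have hkey : ∀ p, T p = p → ∀ t ∈ Set.Ioo 0 b,
      τ * ‖z t - p‖ ^ q ≤ q * jq (z t - p) (u - lam • A p) := by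
    intro p hp t ht
    have ht0 : 0 < t := ht.1
    have htτ : t * τ < 1 := (lt_div_iff₀ hτ).1 (ht.2.trans_le (min_le_right _ _))
    have hs := hsub ((T (z t) - (t * lam) • A (T (z t))) - (p - (t * lam) • A p))
      (t • (u - lam • A p))
    have heq : (T (z t) - (t * lam) • A (T (z t))) - (p - (t * lam) • A p)
        + t • (u - lam • A p) = z t - p := by
      conv_rhs => rw [hz t ht]
      rw [smul_sub, smul_smul]; abel
    rw [heq, map_smul, smul_eq_mul] at hs
    have h1 := hS t ht (T (z t)) p
    have h2 : ‖T (z t) - p‖ ^ q ≤ ‖z t - p‖ ^ q := by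
      apply Real.rpow_le_rpow (norm_nonneg _) _ hq0.le
      have := hT (z t) p
      rwa [hp] at this
    have h3 := mul_le_mul_of_nonneg_left h2 (show 0 ≤ 1 - t * τ by linarith)
    have h4 : t * (τ * ‖z t - p‖ ^ q) ≤ t * (q * jq (z t - p) (u - lam • A p)) := by linarith
    exact le_of_mul_le_mul_left h4 ht0
  -- boundedness
  set M0 := q * ‖u - lam • A p0‖ / τ with hM0
  have hbd : ∀ t ∈ Set.Ioo 0 b, ‖z t - p0‖ ≤ M0 := by
    intro t ht
    by_cases h0 : ‖z t - p0‖ = 0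
    · rw [h0]; positivity
    have hpos : 0 < ‖z t - p0‖ := lt_of_le_of_ne (norm_nonneg _) (Ne.symm h0)
    have h1 := hkey p0 hp0 t ht
    have h2 : jq (z t - p0) (u - lam • A p0) ≤ ‖z t - p0‖ ^ (q - 1) * ‖u - lam • A p0‖ := by
      rw [← (hjq (z t - p0)).2]
      exact (le_abs_self _).trans ((jq (z t - p0)).le_opNorm _)
    have h3 : ‖z t - p0‖ ^ q = ‖z t - p0‖ ^ (q - 1) * ‖z t - p0‖ := by
      rw [← Real.rpow_add_one hpos.ne']; ring_nf
    have h4 : 0 < ‖z t - p0‖ ^ (q - 1) := Real.rpow_pos_of_pos hpos _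
    rw [hM0, le_div_iff₀ hτ]
    rw [h3] at h1
    have h5 : ‖z t - p0‖ ^ (q - 1) * (‖z t - p0‖ * τ) ≤
        ‖z t - p0‖ ^ (q - 1) * (q * ‖u - lam • A p0‖) := by nlinarith
    exact le_of_mul_le_mul_left h5 h4
  have hdiff : ∀ t ∈ Set.Ioo 0 b, z t - T (z t) = t • (u - lam • A (T (z t))) := by
    intro t ht
    conv_lhs => enter [1]; rw [hz t ht]
    rw [smul_sub, smul_smul]; abel
  have hzT : Filter.Tendsto (fun t => ‖z t - T (z t)‖) l (nhds 0) := by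
    have hup : Filter.Tendsto (fun t : ℝ => t * (‖u - lam • A p0‖ + lam * (L * M0))) l (nhds 0) := by
      have : Filter.Tendsto (fun t : ℝ => t) l (nhds 0) := Filter.tendsto_id.mono_left nhdsWithin_le_nhds
      simpa using this.mul_const (‖u - lam • A p0‖ + lam * (L * M0))
    refine squeeze_zero' (Filter.Eventually.of_forall fun t => norm_nonneg _) ?_ hup
    filter_upwards [hmem] with t ht
    rw [hdiff t ht, norm_smul, Real.norm_of_nonneg ht.1.le]
    refine mul_le_mul_of_nonneg_left ?_ ht.1.le
    have h1 : u - lam • A (T (z t)) = (u - lam • A p0) - lam • (A (T (z t)) - A p0) := by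
      rw [smul_sub]; abel
    rw [h1]
    refine (norm_sub_le _ _).trans ?_
    rw [norm_smul, Real.norm_of_nonneg hlam.le]
    have h2 := hLip (T (z t)) p0
    have h3 := hT (z t) p0
    rw [hp0] at h3
    have h4 := h3.trans (hbd t ht)
    gcongr
    exact h2.trans (mul_le_mul_of_nonneg_left h4 hL.le)
  have hU := usmooth_of_q q hq jq dq hdq hsmooth
  have hrad := radius_zero hU q hq jq dq hdq hsmooth T hT l z hzT p0 M0 (hmem.mono hbd) τ hτ
    (fun x => u - lam • A x) (lam * L) (by positivity) (fun x y => by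
      rw [sub_sub_sub_cancel_left, ← smul_sub, norm_smul, Real.norm_of_nonneg hlam.le,
        norm_sub_rev x y, mul_assoc]
      exact mul_le_mul_of_nonneg_left (hLip y x) hlam.le)
    (fun p hp => hmem.mono (hkey p hp))
  obtain ⟨x', hx', hlim⟩ := converges_of_radius T hT l z hrad
  refine ⟨x', hx', fun p hp => ?_, hlim⟩
  have hTcont : Continuous T := by
    refine (LipschitzWith.of_dist_le_mul (K := 1) fun x y => ?_).continuous
    simpa [dist_eq_norm] using hT x y
  have hAcont : Continuous A := by
    refine (LipschitzWith.of_dist_le_mul (K := ⟨L, hL.le⟩) fun x y => ?_).continuous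
    rw [dist_eq_norm, dist_eq_norm]; exact hLip x y
  have hATlim : Filter.Tendsto (fun t => u - lam • A (T (z t))) l (nhds (u - lam • A x')) := by
    have := ((hAcont.comp hTcont).tendsto x').comp hlim
    rw [Function.comp_apply, hx'] at this
    exact (this.const_smul lam).const_sub u
  refine jq_limit_nonpos q hq jq dq hsmooth hsub l (fun t => p - z t)
    (fun t => u - lam • A (T (z t))) _ _ (hlim.const_sub p) hATlim ?_
  filter_upwards [hmem] with t ht
  have h1 : t * jq (p - z t) (u - lam • A (T (z t))) ≤ 0 := by
    rw [← smul_eq_mul, ← map_smul, ← hdiff t ht]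
    have h2 : z t - T (z t) = (T p - T (z t)) - (p - z t) := by rw [hp]; abel
    rw [h2, map_sub, (hjq (p - z t)).1]
    have h3 : jq (p - z t) (T p - T (z t)) ≤ ‖p - z t‖ ^ (q - 1) * ‖p - z t‖ := by
      rw [← (hjq (p - z t)).2]
      refine (le_abs_self _).trans (((jq (p - z t)).le_opNorm _).trans ?_)
      exact mul_le_mul_of_nonneg_left (hT p (z t)) (norm_nonneg _)
    have h4 : ‖p - z t‖ ^ (q - 1) * ‖p - z t‖ = ‖p - z t‖ ^ q := by
      by_cases h0 : ‖p - z t‖ = 0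
      · rw [h0, mul_zero, Real.zero_rpow hq0.ne']
      · rw [← Real.rpow_add_one h0]; ring_nf
    linarith
  exact nonpos_of_mul_nonpos_right h1 ht.1
end

section
/- Let H be a real Hilbert space, T : H → H nonexpansive with F(T) ≠ ∅, A : H → H L-Lipschitzian strongly monotone with constant η > 0, u ∈ H fixed, 0 < λ < 2η/L². Then for each t ∈ (0, min{1, 1/(2ηλ − (λL)²)}) there is a unique z_t with z_t = t u + (I − tλA)Tz_t, and z_t → x′ as t → 0⁺, where x′ ∈ F(T) is the unique solution of ⟨u − λAx′, p − x′⟩ ≤ 0 for all p ∈ F(T). -/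
open scoped RealInnerProductSpace

theorem le_of_sq_le_sq_x {a b : ℝ} (h : a ^ 2 ≤ b ^ 2) (hb : 0 ≤ b) : a ≤ b :=
  (le_abs_self a).trans (abs_le_of_sq_le_sq h hb)

theorem aux_banach {H : Type*} [NormedAddCommGroup H] [CompleteSpace H]
    (f : H → H) (K : ℝ) (hK0 : 0 ≤ K) (hK1 : K < 1)
    (hf : ∀ x y : H, ‖f x - f y‖ ≤ K * ‖x - y‖) : ∃! z : H, z = f z := by
  have hc : ContractingWith ⟨K, hK0⟩ f := by
    refine ⟨?_, LipschitzWith.of_dist_le_mul ?_⟩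
    · exact_mod_cast hK1
    · intro x y
      rw [dist_eq_norm, dist_eq_norm]
      exact hf x y
  refine ⟨hc.fixedPoint, (hc.fixedPoint_isFixedPt).symm, ?_⟩
  intro y hy
  exact hc.fixedPoint_unique hy.symm

theorem aux_mono {H : Type*} [NormedAddCommGroup H] [InnerProductSpace ℝ H]
    (T : H → H) (hT : ∀ x y : H, ‖T x - T y‖ ≤ ‖x - y‖) (x y : H) :
    0 ≤ ⟪(x - T x) - (y - T y), x - y⟫ := by
  have h1 : (x - T x) - (y - T y) = (x - y) - (T x - T y) := by abel
  rw [h1, inner_sub_left, real_inner_self_eq_norm_sq]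
  have h2 := real_inner_le_norm (T x - T y) (x - y)
  have h3 := mul_le_mul_of_nonneg_right (hT x y) (norm_nonneg (x - y))
  nlinarith

theorem aux_polar {H : Type*} [NormedAddCommGroup H] [InnerProductSpace ℝ H]
    (a b : H) (r s : ℝ) (h : ⟪r • a - s • b, a - b⟫ ≤ 0) (hs : 0 < s) (hr : s < r) :
    ‖a - b‖ ^ 2 ≤ ‖b‖ ^ 2 - ‖a‖ ^ 2 := by
  have e := norm_sub_sq_real a b
  rw [inner_sub_left, inner_sub_right, inner_sub_right] at h
  simp only [real_inner_smul_left, real_inner_self_eq_norm_sq, real_inner_comm a b] at h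
  have h5 : (r + s) * ‖a - b‖ ^ 2 + (r - s) * (‖a‖ ^ 2 - ‖b‖ ^ 2) ≤ 0 := by
    rw [e]; nlinarith
  have h6 : (r - s) * (‖a - b‖ ^ 2 + (‖a‖ ^ 2 - ‖b‖ ^ 2)) ≤ 0 := by
    nlinarith [sq_nonneg ‖a - b‖, mul_nonneg hs.le (sq_nonneg ‖a - b‖)]
  have h7 : ‖a - b‖ ^ 2 + (‖a‖ ^ 2 - ‖b‖ ^ 2) ≤ 0 := by
    by_contra hcon
    push Not at hcon
    have := mul_pos (sub_pos.2 hr) hcon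
    linarith
  linarith

theorem aux_browder {H : Type*} [NormedAddCommGroup H] [InnerProductSpace ℝ H] [CompleteSpace H]
    (T : H → H) (hT : ∀ x y : H, ‖T x - T y‖ ≤ ‖x - y‖)
    (hF : ∃ p : H, T p = p) (v : H) :
    ∃ (y : ℝ → H) (q : H), (∀ t ∈ Set.Ioo (0 : ℝ) 1, y t = t • v + (1 - t) • T (y t)) ∧
      Filter.Tendsto y (nhdsWithin 0 (Set.Ioi 0)) (nhds q) ∧
      T q = q ∧ ∀ p : H, T p = p → ⟪v - q, p - q⟫ ≤ 0 := by
  have hex : ∀ t : ℝ, ∃ z : H, t ∈ Set.Ioo (0 : ℝ) 1 → z = t • v + (1 - t) • T z := by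
    intro t
    by_cases ht : t ∈ Set.Ioo (0 : ℝ) 1
    · obtain ⟨z, hz, -⟩ := aux_banach (fun z => t • v + (1 - t) • T z) (1 - t)
        (by linarith [ht.2]) (by linarith [ht.1]) (by
          intro x y
          have : t • v + (1 - t) • T x - (t • v + (1 - t) • T y) = (1 - t) • (T x - T y) := by
            rw [smul_sub]; abel
          simp only [this]
          rw [norm_smul, Real.norm_of_nonneg (by linarith [ht.2])]
          exact mul_le_mul_of_nonneg_left (hT x y) (by linarith [ht.2]))
      exact ⟨z, fun _ => hz⟩
    · exact ⟨0, fun h => absurd h ht⟩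
  choose y hy using hex
  -- residual
  have hres : ∀ t ∈ Set.Ioo (0 : ℝ) 1, y t - T (y t) = -((t / (1 - t)) • (y t - v)) := by
    intro t ht
    have h1 : (1 - t) ≠ 0 := by linarith [ht.2]
    have h2 := hy t ht
    have h3 : (1 - t) • (y t - T (y t)) = (1 - t) • (-((t / (1 - t)) • (y t - v))) := by
      rw [smul_neg, smul_smul, mul_div_cancel₀ _ h1]
      have h4 : (1 - t) • T (y t) = y t - t • v := by
        rw [eq_sub_iff_add_eq, add_comm]; exact h2.symm
      rw [smul_sub, h4]
      module
    exact smul_right_injective H h1 h3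
  have hrpos : ∀ t ∈ Set.Ioo (0 : ℝ) 1, 0 < t / (1 - t) := fun t ht =>
    div_pos ht.1 (by linarith [ht.2])
  have hvi : ∀ t ∈ Set.Ioo (0 : ℝ) 1, ∀ p : H, T p = p → ⟪v - y t, p - y t⟫ ≤ 0 := by
    intro t ht p hp
    have h := aux_mono T hT (y t) p
    rw [hres t ht, hp, sub_self, sub_zero, ← smul_neg, real_inner_smul_left] at h
    have h2 := nonneg_of_mul_nonneg_right h (hrpos t ht)
    have h3 : ⟪v - y t, p - y t⟫ = -⟪-(y t - v), y t - p⟫ := by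
      rw [← inner_neg_right, neg_sub, neg_sub]
    linarith
  have hmon : ∀ s ∈ Set.Ioo (0 : ℝ) 1, ∀ t ∈ Set.Ioo (0 : ℝ) 1, s < t →
      ‖y t - y s‖ ^ 2 ≤ ‖y s - v‖ ^ 2 - ‖y t - v‖ ^ 2 := by
    intro s hs t ht hst
    have h := aux_mono T hT (y t) (y s)
    rw [hres t ht, hres s hs] at h
    have h2 := aux_polar (y t - v) (y s - v) (t / (1 - t)) (s / (1 - s)) (by
      have e1 : (y t - v) - (y s - v) = y t - y s := by abel
      have e2 : (t / (1 - t)) • (y t - v) - (s / (1 - s)) • (y s - v) =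
        -(-((t / (1 - t)) • (y t - v)) - -((s / (1 - s)) • (y s - v))) := by abel
      rw [e1, e2, inner_neg_left]
      linarith) (hrpos s hs) (by
        rw [div_lt_div_iff₀ (by linarith [hs.2]) (by linarith [ht.2])]
        nlinarith)
    have e1 : (y t - v) - (y s - v) = y t - y s := by abel
    rwa [e1] at h2
  obtain ⟨p0, hp0⟩ := hF
  have hbd : ∀ t ∈ Set.Ioo (0 : ℝ) 1, ‖y t - v‖ ≤ ‖p0 - v‖ := by
    intro t ht
    have h := hvi t ht p0 hp0
    have e : p0 - v = (p0 - y t) - (v - y t) := by abel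
    have h2 := norm_sub_sq_real (p0 - y t) (v - y t)
    rw [← e, real_inner_comm] at h2
    rw [norm_sub_rev (y t) v]
    apply le_of_sq_le_sq_x _ (norm_nonneg _)
    nlinarith [sq_nonneg ‖p0 - y t‖]
  -- Cauchy
  have hIoo : ∀ t : ℝ, 0 < t → Set.Ioo (0 : ℝ) t ∈ nhdsWithin (0 : ℝ) (Set.Ioi 0) := fun t ht =>
    Ioo_mem_nhdsGT ht
  have hcau : Cauchy (Filter.map y (nhdsWithin 0 (Set.Ioi 0))) := by
    rw [Metric.cauchy_iff]
    refine ⟨inferInstance, ?_⟩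
    intro ε hε
    set S : Set ℝ := (fun t => ‖y t - v‖ ^ 2) '' Set.Ioo (0 : ℝ) 1 with hS
    have hSne : S.Nonempty := ⟨_, 1 / 2, by norm_num, rfl⟩
    have hSb : BddAbove S := by
      refine ⟨‖p0 - v‖ ^ 2, ?_⟩
      rintro _ ⟨t, ht, rfl⟩
      exact pow_le_pow_left₀ (norm_nonneg _) (hbd t ht) 2
    obtain ⟨_, ⟨t0, ht0, rfl⟩, hlt⟩ := exists_lt_of_lt_csSup hSne
      (show sSup S - (ε / 2) ^ 2 < sSup S by nlinarith [sq_pos_of_pos (half_pos hε)])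
    refine ⟨y '' Set.Ioo 0 t0, Filter.image_mem_map (hIoo t0 ht0.1), ?_⟩
    have key : ∀ s ∈ Set.Ioo (0 : ℝ) t0, ‖y t0 - y s‖ < ε / 2 := by
      intro s hs
      have hs1 : s ∈ Set.Ioo (0 : ℝ) 1 := ⟨hs.1, hs.2.trans ht0.2⟩
      have h1 := hmon s hs1 t0 ht0 hs.2
      have h2 : ‖y s - v‖ ^ 2 ≤ sSup S := le_csSup hSb ⟨s, hs1, rfl⟩
      apply lt_of_pow_lt_pow_left₀ 2 (by positivity)
      simp only at hlt
      linarith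
    rintro _ ⟨s, hs, rfl⟩ _ ⟨s', hs', rfl⟩
    have h1 := key s hs
    have h2 := key s' hs'
    rw [← dist_eq_norm] at h1 h2
    linarith [dist_triangle_left (y s) (y s') (y t0)]
  obtain ⟨q, hq⟩ := CompleteSpace.complete hcau
  have hq : Filter.Tendsto y (nhdsWithin 0 (Set.Ioi 0)) (nhds q) := hq
  have hTc : Continuous T := by
    have : LipschitzWith 1 T := LipschitzWith.of_dist_le_mul (by
      intro x y; simpa [dist_eq_norm] using hT x y)
    exact this.continuous
  have hid : Filter.Tendsto (fun t : ℝ => t) (nhdsWithin 0 (Set.Ioi 0)) (nhds 0) :=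
    Filter.tendsto_id.mono_left nhdsWithin_le_nhds
  refine ⟨y, q, hy, hq, ?_, ?_⟩
  · have h1 : Filter.Tendsto (fun t : ℝ => t • v + (1 - t) • T (y t))
        (nhdsWithin 0 (Set.Ioi 0)) (nhds ((0 : ℝ) • v + (1 - (0 : ℝ)) • T q)) :=
      (hid.smul_const v).add ((tendsto_const_nhds.sub hid).smul ((hTc.tendsto q).comp hq))
    have h2 : Filter.Tendsto y
        (nhdsWithin 0 (Set.Ioi 0)) (nhds ((0 : ℝ) • v + (1 - (0 : ℝ)) • T q)) := by
      refine h1.congr' ?_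
      filter_upwards [hIoo 1 one_pos] with t ht
      exact (hy t ht).symm
    have h3 := tendsto_nhds_unique h2 hq
    simpa using h3
  · intro p hp
    have h1 : Filter.Tendsto (fun t => ⟪v - y t, p - y t⟫) (nhdsWithin 0 (Set.Ioi 0))
        (nhds ⟪v - q, p - q⟫) :=
      (tendsto_const_nhds.sub hq).inner (tendsto_const_nhds.sub hq)
    refine le_of_tendsto h1 ?_
    filter_upwards [hIoo 1 one_pos] with t ht
    exact hvi t ht p hp

theorem aux_proj {H : Type*} [NormedAddCommGroup H] [InnerProductSpace ℝ H]
    (a b p q : H) (h1 : ⟪a - p, q - p⟫ ≤ 0) (h2 : ⟪b - q, p - q⟫ ≤ 0) :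
    ‖p - q‖ ≤ ‖a - b‖ := by
  have h3 : ‖p - q‖ ^ 2 ≤ ⟪a - b, p - q⟫ := by
    have e1 : ⟪a - p, q - p⟫ = -⟪a - p, p - q⟫ := by rw [← inner_neg_right, neg_sub]
    have e2 : a - b = (a - p) + (p - q) - (b - q) := by abel
    rw [e2, inner_sub_left, inner_add_left, real_inner_self_eq_norm_sq]
    linarith
  have h4 := real_inner_le_norm (a - b) (p - q)
  by_contra hcon
  push Not at hcon
  have h5 : 0 < ‖p - q‖ := lt_of_le_of_lt (norm_nonneg _) hcon
  nlinarith

/-- In a real Hilbert space, with `T` nonexpansive, `F(T) ≠ ∅`, `A`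
`L`-Lipschitzian strongly monotone with constant `η > 0`, `0 < λ < 2η/L²`: for each
`t ∈ (0, min{1, 1/(2ηλ - (λL)²)})` there is a unique `z_t` with
`z_t = t u + (I - tλA) T z_t`, and `z_t → x′` as `t → 0⁺`, where `x′ ∈ F(T)` is the
unique solution of `⟨u - λAx′, p - x′⟩ ≤ 0` for all `p ∈ F(T)`. -/
theorem hilbert_implicit_path_converges
    {H : Type*} [NormedAddCommGroup H] [InnerProductSpace ℝ H] [CompleteSpace H]
    (T : H → H) (hT : ∀ x y : H, ‖T x - T y‖ ≤ ‖x - y‖)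
    (hF : ∃ p : H, T p = p)
    (A : H → H) (L : ℝ) (hL : 0 < L)
    (hLip : ∀ x y : H, ‖A x - A y‖ ≤ L * ‖x - y‖)
    (η : ℝ) (hη : 0 < η)
    (hA : ∀ x y : H, η * ‖x - y‖ ^ 2 ≤ ⟪A x - A y, x - y⟫)
    (u : H)
    (lam : ℝ) (hlam : 0 < lam) (hlam' : lam < 2 * η / L ^ 2) :
    (∀ t ∈ Set.Ioo (0 : ℝ) (min 1 (1 / (2 * η * lam - (lam * L) ^ 2))),
      ∃! z : H, z = t • u + (T z - (t * lam) • A (T z))) ∧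
    ∃ x' : H, T x' = x' ∧
      (∀ p : H, T p = p → ⟪u - lam • A x', p - x'⟫ ≤ 0) ∧
      (∀ y : H, T y = y →
        (∀ p : H, T p = p → ⟪u - lam • A y, p - y⟫ ≤ 0) → y = x') ∧
      ∀ z : ℝ → H,
        (∀ t ∈ Set.Ioo (0 : ℝ) (min 1 (1 / (2 * η * lam - (lam * L) ^ 2))),
          z t = t • u + (T (z t) - (t * lam) • A (T (z t)))) →
        Filter.Tendsto z
          (nhdsWithin 0 (Set.Ioo (0 : ℝ) (min 1 (1 / (2 * η * lam - (lam * L) ^ 2)))))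
          (nhds x') := by
  set c : ℝ := 2 * η * lam - (lam * L) ^ 2 with hc
  have hcpos : 0 < c := by
    rw [lt_div_iff₀ (by positivity)] at hlam'
    have : 0 < lam * (2 * η - lam * L ^ 2) := mul_pos hlam (by linarith)
    rw [hc]; nlinarith
  have hmin : 0 < min 1 (1 / c) := lt_min one_pos (by positivity)
  have htc : ∀ t ∈ Set.Ioo (0 : ℝ) (min 1 (1 / c)), 0 < t ∧ t < 1 ∧ t * c < 1 := by
    intro t ht
    refine ⟨ht.1, lt_of_lt_of_le ht.2 (min_le_left _ _), ?_⟩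
    have := lt_of_lt_of_le ht.2 (min_le_right _ _)
    rwa [lt_div_iff₀ hcpos] at this
  have hG : ∀ t ∈ Set.Ioo (0 : ℝ) (min 1 (1 / c)), ∀ x y : H,
      ‖(x - (t * lam) • A x) - (y - (t * lam) • A y)‖ ≤ (1 - t * c / 2) * ‖x - y‖ := by
    intro t ht x y
    obtain ⟨h0, h1, h2⟩ := htc t ht
    have e : (x - (t * lam) • A x) - (y - (t * lam) • A y)
        = (x - y) - (t * lam) • (A x - A y) := by rw [smul_sub]; abel
    rw [e]
    apply le_of_sq_le_sq_x _ (mul_nonneg (by linarith) (norm_nonneg _))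
    rw [norm_sub_sq_real, norm_smul, real_inner_smul_right, real_inner_comm,
      Real.norm_of_nonneg (by positivity)]
    have h3 := hA x y
    have h4 : ‖A x - A y‖ ^ 2 ≤ (L * ‖x - y‖) ^ 2 :=
      pow_le_pow_left₀ (norm_nonneg _) (hLip x y) 2
    have h5 := mul_le_mul_of_nonneg_left h3 (show 0 ≤ 2 * (t * lam) by positivity)
    have h6 := mul_le_mul_of_nonneg_left h4 (show 0 ≤ (t * lam) ^ 2 by positivity)
    have h7 : 0 ≤ (t - t ^ 2) * ((lam * L) ^ 2 * ‖x - y‖ ^ 2) :=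
      mul_nonneg (by nlinarith) (by positivity)
    have h8 : 0 ≤ (t * c / 2) ^ 2 * ‖x - y‖ ^ 2 := by positivity
    have h9 : ((1 - t * c / 2) * ‖x - y‖) ^ 2 =
      ‖x - y‖ ^ 2 - t * (2 * η * lam - (lam * L) ^ 2) * ‖x - y‖ ^ 2
        + (t * c / 2) ^ 2 * ‖x - y‖ ^ 2 := by rw [← hc]; ring
    rw [h9]
    nlinarith
  have hS : ∀ t ∈ Set.Ioo (0 : ℝ) (min 1 (1 / c)), ∀ x y : H,
      ‖(t • u + (T x - (t * lam) • A (T x))) - (t • u + (T y - (t * lam) • A (T y)))‖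
        ≤ (1 - t * c / 2) * ‖x - y‖ := by
    intro t ht x y
    obtain ⟨h0, h1, h2⟩ := htc t ht
    rw [add_sub_add_left_eq_sub]
    exact (hG t ht _ _).trans (mul_le_mul_of_nonneg_left (hT x y) (by linarith))
  refine ⟨?_, ?_⟩
  · intro t ht
    obtain ⟨h0, h1, h2⟩ := htc t ht
    exact aux_banach (fun z => t • u + (T z - (t * lam) • A (T z))) (1 - t * c / 2)
      (by linarith) (by nlinarith [mul_pos h0 hcpos]) (hS t ht)
  -- existence of the solution of the variational inequality
  have hB := aux_browder T hT hF
  choose yy Q hyy hyQ hQF hQ using hB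
  have hQl : ∀ a b : H, ‖Q a - Q b‖ ≤ ‖a - b‖ := fun a b =>
    aux_proj a b (Q a) (Q b) (hQ a _ (hQF b)) (hQ b _ (hQF a))
  have hμ : min 1 (1 / c) / 2 ∈ Set.Ioo (0 : ℝ) (min 1 (1 / c)) := ⟨by linarith, by linarith⟩
  obtain ⟨m, hm⟩ : ∃ m, m ∈ Set.Ioo (0 : ℝ) (min 1 (1 / c)) := ⟨_, hμ⟩
  obtain ⟨hm0, hm1, hm2⟩ := htc m hm
  obtain ⟨x', hx', -⟩ := aux_banach (fun x => Q (m • u + (x - (m * lam) • A x))) (1 - m * c / 2)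
    (by linarith) (by nlinarith [mul_pos hm0 hcpos]) (by
      intro x y
      refine (hQl _ _).trans ?_
      rw [add_sub_add_left_eq_sub]
      exact hG m hm x y)
  have hTx : T x' = x' := by rw [hx']; exact hQF _
  have hVI : ∀ p : H, T p = p → ⟪u - lam • A x', p - x'⟫ ≤ 0 := by
    intro p hp
    have h := hQ (m • u + (x' - (m * lam) • A x')) p hp
    rw [← hx'] at h
    have e : m • u + (x' - (m * lam) • A x') - x' = m • (u - lam • A x') := by
      rw [smul_sub, smul_smul]; abel
    rw [e, real_inner_smul_left] at h
    by_contra hcon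
    push Not at hcon
    linarith [mul_pos hm0 hcon]
  refine ⟨x', hTx, hVI, ?_, ?_⟩
  · intro y hTy hy
    have h1 := hy x' hTx
    have h2 := hVI y hTy
    have h3 := hA y x'
    have e1 : ⟪u - lam • A y, x' - y⟫ = -⟪u - lam • A y, y - x'⟫ := by
      rw [← inner_neg_right, neg_sub]
    have e2 : ⟪u - lam • A x', y - x'⟫ - ⟪u - lam • A y, y - x'⟫ = lam * ⟪A y - A x', y - x'⟫ := by
      rw [← inner_sub_left, ← real_inner_smul_left, smul_sub]
      congr 1
      abel
    have h4 : lam * (η * ‖y - x'‖ ^ 2) ≤ 0 := by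
      have := mul_le_mul_of_nonneg_left h3 hlam.le
      linarith
    by_contra hne
    have h5 : 0 < ‖y - x'‖ := norm_pos_iff.2 (sub_ne_zero.2 hne)
    have : 0 < lam * (η * ‖y - x'‖ ^ 2) := by positivity
    linarith
  · intro z hz
    obtain ⟨v, hv⟩ : ∃ v, v = x' + (u - lam • A x') := ⟨_, rfl⟩
    have hQv : Q v = x' := by
      have h1 : ⟪v - x', Q v - x'⟫ ≤ 0 := by
        have := hVI (Q v) (hQF v)
        rwa [hv, add_sub_cancel_left, ← hv]
      have h := aux_proj v v (Q v) x' (hQ v x' hTx) h1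
      rw [sub_self, norm_zero] at h
      exact sub_eq_zero.1 (norm_le_zero_iff.1 h)
    have hlim := hyQ v
    rw [hQv] at hlim
    have hle : nhdsWithin (0 : ℝ) (Set.Ioo 0 (min 1 (1 / c))) ≤ nhdsWithin 0 (Set.Ioi 0) :=
      nhdsWithin_mono _ Set.Ioo_subset_Ioi_self
    have hlim2 := hlim.mono_left hle
    have hbound : ∀ t ∈ Set.Ioo (0 : ℝ) (min 1 (1 / c)),
        ‖z t - x'‖ ≤ (2 / c * (1 + lam * L) + 1) * ‖yy v t - x'‖ := by
      intro t ht
      obtain ⟨h0, h1, h2⟩ := htc t ht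
      have hzt := hz t ht
      have hyt := hyy v t ⟨h0, h1⟩
      have hs := hS t ht (z t) (yy v t)
      rw [← hzt] at hs
      set y := yy v t with hydef
      have e : (t • u + (T y - (t * lam) • A (T y))) - y
          = t • ((T y - x') - lam • (A (T y) - A x')) := by
        have : (t • u + (T y - (t * lam) • A (T y))) - y
          = (t • u + (T y - (t * lam) • A (T y))) - (t • v + (1 - t) • T y) := by
            rw [← hyt]
        rw [this, hv]
        module
      have hTy : ‖T y - x'‖ ≤ ‖y - x'‖ := by
        have := hT y x'
        rwa [hTx] at this
      have hr : ‖(t • u + (T y - (t * lam) • A (T y))) - y‖ ≤ t * ((1 + lam * L) * ‖y - x'‖) := by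
        rw [e, norm_smul, Real.norm_of_nonneg h0.le]
        apply mul_le_mul_of_nonneg_left _ h0.le
        refine (norm_sub_le _ _).trans ?_
        rw [norm_smul, Real.norm_of_nonneg hlam.le]
        have a1 := mul_le_mul_of_nonneg_left (hLip (T y) x') hlam.le
        have a2 := mul_le_mul_of_nonneg_left hTy (mul_pos hlam hL).le
        nlinarith
      have htri := norm_sub_le_norm_sub_add_norm_sub (z t)
        (t • u + (T y - (t * lam) • A (T y))) y
      have h3 : t * (c / 2 * ‖z t - y‖) ≤ t * ((1 + lam * L) * ‖y - x'‖) := by nlinarith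
      have h4 := le_of_mul_le_mul_left h3 h0
      have h5 : ‖z t - y‖ ≤ 2 / c * (1 + lam * L) * ‖y - x'‖ := by
        have h6 := mul_le_mul_of_nonneg_left h4 (show 0 ≤ 2 / c by positivity)
        have e3 : 2 / c * (c / 2 * ‖z t - y‖) = ‖z t - y‖ := by field_simp
        rw [e3] at h6
        linarith
      have h7 := norm_sub_le_norm_sub_add_norm_sub (z t) y x'
      linarith
    rw [tendsto_iff_norm_sub_tendsto_zero] at hlim2 ⊢
    have h0 := hlim2.const_mul (2 / c * (1 + lam * L) + 1)
    rw [mul_zero] at h0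
    refine squeeze_zero' (Filter.Eventually.of_forall fun _ => norm_nonneg _) ?_ h0
    filter_upwards [self_mem_nhdsWithin] with t ht
    exact hbound t ht
end
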